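/- For odd h, the minimal l such that S^h can be covered by open sets, none containing a pair of antipodal points, with every point contained in at most l of the sets, equals (h-1)/2 + 2 = (h+3)/2. -/

import Mathlib

open Finsupp

section Chains

variable {α β : Type*}

/-- Mod-2 chains on ordered tuples of points, a tuple being a list of vertices. -/
abbrev TupleChain (α : Type*) := List α →₀ ZMod 2

namespace TupleChain

/-- Append the vertex `x` in front of every tuple. -/
noncomputable def cons (x : α) : TupleChain α →ₗ[ZMod 2] TupleChain α :=
  lmapDomain (ZMod 2) (ZMod 2) (List.cons x)

/-- Push a chain forward along a map of vertices. -/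
noncomputable def map (f : α → β) : TupleChain α →ₗ[ZMod 2] TupleChain β :=
  lmapDomain (ZMod 2) (ZMod 2) (List.map f)

/-- The boundary of a single tuple. -/
noncomputable def listBoundary : List α → TupleChain α
  | [] => 0
  | x :: l => single l 1 + cons x (listBoundary l)

/-- The augmented mod-2 boundary operator. -/
noncomputable def boundary : TupleChain α →ₗ[ZMod 2] TupleChain α :=
  linearCombination (ZMod 2) listBoundary

/-- The prism over a single tuple with bottom given by `f` and top given by `g`. -/
noncomputable def listPrism (f g : α → β) : List α → TupleChain β
  | [] => 0
  | x :: l => single (f x :: g x :: l.map g) 1 + cons (f x) (listPrism f g l)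

/-- The prism operator from `f` to `g`. -/
noncomputable def prism (f g : α → β) : TupleChain α →ₗ[ZMod 2] TupleChain β :=
  linearCombination (ZMod 2) (listPrism f g)

@[simp] lemma cons_single (x : α) (l : List α) (a : ZMod 2) :
    cons x (single l a) = single (x :: l) a := by
  simp [cons]

@[simp] lemma map_single (f : α → β) (l : List α) (a : ZMod 2) :
    map f (single l a) = single (l.map f) a := by
  simp [map]

@[simp] lemma boundary_single (l : List α) : boundary (single l 1) = listBoundary l := by
  simp [boundary]

@[simp] lemma prism_single (f g : α → β) (l : List α) :
    prism f g (single l 1) = listPrism f g l := by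
  simp [prism]

lemma hom_ext {M : Type*} [AddCommMonoid M] [Module (ZMod 2) M]
    {f g : TupleChain α →ₗ[ZMod 2] M} (h : ∀ l, f (single l 1) = g (single l 1)) : f = g := by
  ext l
  simpa using h l

lemma boundary_cons (x : α) (c : TupleChain α) :
    boundary (cons x c) = c + cons x (boundary c) := by
  have : boundary ∘ₗ cons x = LinearMap.id + cons x ∘ₗ boundary :=
    hom_ext fun l => by simp [listBoundary]
  exact LinearMap.congr_fun this c

lemma prism_cons (f g : α → β) (x : α) (c : TupleChain α) :
    prism f g (cons x c) = cons (f x) (cons (g x) (map g c)) + cons (f x) (prism f g c) := by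
  have : prism f g ∘ₗ cons x =
      cons (f x) ∘ₗ cons (g x) ∘ₗ map g + cons (f x) ∘ₗ prism f g :=
    hom_ext fun l => by simp [listPrism]
  exact LinearMap.congr_fun this c

lemma map_cons (f : α → β) (x : α) (c : TupleChain α) :
    map f (cons x c) = cons (f x) (map f c) := by
  have : map f ∘ₗ cons x = cons (f x) ∘ₗ map f := hom_ext fun l => by simp
  exact LinearMap.congr_fun this c

lemma map_listBoundary (f : α → β) (l : List α) :
    map f (listBoundary l) = listBoundary (l.map f) := by
  induction l with
  | nil => simp [listBoundary]
  | cons x l ih => simp [listBoundary, map_cons, ih]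

lemma boundary_map (f : α → β) (c : TupleChain α) :
    boundary (map f c) = map f (boundary c) := by
  have : boundary ∘ₗ map f = map f ∘ₗ boundary :=
    hom_ext fun l => by simp [map_listBoundary]
  exact LinearMap.congr_fun this c

lemma map_map {γ : Type*} (g : β → γ) (f : α → β) (c : TupleChain α) :
    map g (map f c) = map (g ∘ f) c := by
  have : map g ∘ₗ map f = map (g ∘ f) := hom_ext fun l => by simp
  exact LinearMap.congr_fun this c

lemma boundary_listPrism (f g : α → β) (l : List α) :
    boundary (listPrism f g l) + prism f g (listBoundary l) =
      single (l.map f) 1 + single (l.map g) 1 := by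
  induction l with
  | nil => simp [listPrism, listBoundary, ZModModule.add_self]
  | cons x l ih =>
    have ih' := congrArg (cons (f x)) ih
    simp only [map_add, cons_single] at ih'
    simp only [listPrism, listBoundary, map_add, boundary_single, boundary_cons, prism_single,
      prism_cons, cons_single, map_listBoundary, List.map_cons]
    have e1 := ZModModule.add_self (listPrism f g l)
    have e2 := ZModModule.add_self (cons (f x) (cons (g x) (listBoundary (l.map g))))
    have e3 := ZModModule.add_self (single (f x :: l.map g) (1 : ZMod 2))
    linear_combination (norm := abel) ih' + e1 + e2 + e3

lemma boundary_prism (f g : α → β) (c : TupleChain α) :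
    boundary (prism f g c) + prism f g (boundary c) = map f c + map g c := by
  have : boundary ∘ₗ prism f g + prism f g ∘ₗ boundary = map f + map g :=
    hom_ext fun l => by simp [boundary_listPrism]
  exact LinearMap.congr_fun this c

lemma linearCombination_mem {M : Type*} [AddCommMonoid M] [Module (ZMod 2) M]
    {v : List α → M} {S : Set (List α)} {p : Submodule (ZMod 2) M}
    (h : ∀ l ∈ S, v l ∈ p) {c : TupleChain α} (hc : c ∈ supported (ZMod 2) (ZMod 2) S) :
    linearCombination (ZMod 2) v c ∈ p :=
  p.sum_mem fun l hl => p.smul_mem _ (h l (hc hl))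

lemma map_mem {f : α → β} {S : Set (List α)} {T : Set (List β)} (h : ∀ l ∈ S, l.map f ∈ T)
    {c : TupleChain α} (hc : c ∈ supported (ZMod 2) (ZMod 2) S) :
    map f c ∈ supported (ZMod 2) (ZMod 2) T := by
  have : map f = linearCombination (ZMod 2) fun l => single (l.map f) 1 :=
    hom_ext fun l => by simp
  rw [this]
  exact linearCombination_mem (fun l hl => single_mem_supported _ _ (h l hl)) hc

lemma listPrism_mem (f g : α → β) (l : List α) :
    listPrism f g l ∈ supported (ZMod 2) (ZMod 2)
      {t | t.length = l.length + 1 ∧ ∀ y ∈ t, ∃ x ∈ l, y = f x ∨ y = g x} := by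
  induction l with
  | nil => exact Submodule.zero_mem _
  | cons x l ih =>
    refine Submodule.add_mem _ (single_mem_supported _ _ ?_) ?_
    · simp
      grind
    · rw [cons, mem_supported]
      classical
      intro t ht
      obtain ⟨t', ht', rfl⟩ := Finset.mem_image.1 (mapDomain_support ht)
      have := ih ht'
      simp only [Set.mem_ofPred_eq, List.length_cons, List.mem_cons] at this ⊢
      grind

section Fan

variable (key : α → ℕ) (sgn : α → Bool)

/-- Indicator that the signs along a tuple alternate, beginning with `b`. -/
def alternating (b : Bool) : List α → ZMod 2
  | [] => 1
  | x :: l => if sgn x = b then alternating (!b) l else 0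

/-- Evaluate the alternation indicator after sorting every tuple by `key`. -/
noncomputable def fan (b : Bool) : TupleChain α →ₗ[ZMod 2] ZMod 2 :=
  linearCombination (ZMod 2) fun l =>
    alternating sgn b (l.insertionSort fun x y => key x ≤ key y)

/-- Evaluate the alternation indicator on tuples as they stand. -/
noncomputable def evalAlternating (b : Bool) : TupleChain α →ₗ[ZMod 2] ZMod 2 :=
  linearCombination (ZMod 2) (alternating sgn b)

/-- Insert a vertex in every tuple at the place dictated by `key`. -/
noncomputable def insert (x : α) : TupleChain α →ₗ[ZMod 2] TupleChain α :=
  lmapDomain (ZMod 2) (ZMod 2) (List.orderedInsert (fun x y => key x ≤ key y) x)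

/-- Sort every tuple by `key`. -/
noncomputable def sort : TupleChain α →ₗ[ZMod 2] TupleChain α :=
  lmapDomain (ZMod 2) (ZMod 2) (List.insertionSort fun x y => key x ≤ key y)

@[simp] lemma insert_single (x : α) (l : List α) (a : ZMod 2) :
    insert key x (single l a) = single (l.orderedInsert (fun x y => key x ≤ key y) x) a := by
  simp [insert]

@[simp] lemma sort_single (l : List α) (a : ZMod 2) :
    sort key (single l a) = single (l.insertionSort fun x y => key x ≤ key y) a := by
  simp [sort]

lemma sort_cons (x : α) (c : TupleChain α) :
    sort key (cons x c) = insert key x (sort key c) := by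
  have : sort key ∘ₗ cons x = insert key x ∘ₗ sort key := hom_ext fun l => by simp
  exact LinearMap.congr_fun this c

lemma insert_cons_of_le {x y : α} (h : key x ≤ key y) (c : TupleChain α) :
    insert key x (cons y c) = cons x (cons y c) := by
  have : insert key x ∘ₗ cons y = cons x ∘ₗ cons y := hom_ext fun l => by simp [h]
  exact LinearMap.congr_fun this c

lemma insert_cons_of_lt {x y : α} (h : key y < key x) (c : TupleChain α) :
    insert key x (cons y c) = cons y (insert key x c) := by
  have : insert key x ∘ₗ cons y = cons y ∘ₗ insert key x :=
    hom_ext fun l => by simp [h.not_ge]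
  exact LinearMap.congr_fun this c

lemma listBoundary_orderedInsert (x : α) {l : List α}
    (hl : l.Pairwise fun x y => key x ≤ key y) :
    listBoundary (l.orderedInsert (fun x y => key x ≤ key y) x) =
      single l 1 + insert key x (listBoundary l) := by
  induction l with
  | nil => simp [listBoundary]
  | cons y l ih =>
    rw [List.pairwise_cons] at hl
    rcases le_or_gt (key x) (key y) with h | h
    · have hx : l.orderedInsert (fun x y => key x ≤ key y) x = x :: l := by
        cases l with
        | nil => rfl
        | cons z l => simp [h.trans (hl.1 z (by simp))]
      simp [listBoundary, h, insert_cons_of_le key h, hx]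
    · simp only [List.orderedInsert, h.not_ge, if_false, listBoundary, ih hl.2, map_add,
        cons_single, insert_single, insert_cons_of_lt key h]
      abel

lemma listBoundary_insertionSort (l : List α) :
    listBoundary (l.insertionSort fun x y => key x ≤ key y) = sort key (listBoundary l) := by
  induction l with
  | nil => simp [listBoundary]
  | cons x l ih =>
    have : (l.insertionSort fun x y => key x ≤ key y).Pairwise fun x y => key x ≤ key y := by
      have : Std.Total fun x y : α => key x ≤ key y := ⟨fun x y => le_total _ _⟩
      have : IsTrans α fun x y : α => key x ≤ key y := ⟨fun x y z => le_trans⟩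
      exact List.pairwise_insertionSort _ l
    rw [List.insertionSort_cons, listBoundary_orderedInsert key x this, ih]
    simp [listBoundary, sort_cons]

lemma evalAlternating_cons (b : Bool) (x : α) (c : TupleChain α) :
    evalAlternating sgn b (cons x c) = if sgn x = b then evalAlternating sgn (!b) c else 0 := by
  have : evalAlternating sgn b ∘ₗ cons x = if sgn x = b then evalAlternating sgn (!b) else 0 :=
    hom_ext fun l => by by_cases h : sgn x = b <;> simp [evalAlternating, alternating, h]
  have := LinearMap.congr_fun this c
  split_ifs at this ⊢ <;> exact this

lemma evalAlternating_listBoundary (b : Bool) (l : List α) :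
    evalAlternating sgn b (listBoundary l) = alternating sgn true l + alternating sgn false l := by
  induction l generalizing b with
  | nil => simpa [listBoundary, alternating] using (CharTwo.add_self_eq_zero (1 : ZMod 2)).symm
  | cons x l ih =>
    rw [listBoundary, map_add, evalAlternating_cons, ih]
    have e1 := CharTwo.add_self_eq_zero (alternating sgn true l)
    have e2 := CharTwo.add_self_eq_zero (alternating sgn false l)
    have e0 : evalAlternating sgn b (single l 1) = alternating sgn b l := by
      simp [evalAlternating]
    rw [e0]
    cases b <;> cases hx : sgn x <;> simp [alternating, hx] <;>
      first | linear_combination e1 | linear_combination e2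

lemma fan_boundary (c : TupleChain α) :
    fan key sgn true (boundary c) = fan key sgn true c + fan key sgn false c := by
  have h : ∀ b, fan key sgn b = evalAlternating sgn b ∘ₗ sort key := fun b =>
    hom_ext fun l => by simp [fan, evalAlternating]
  have : fan key sgn true ∘ₗ boundary = fan key sgn true + fan key sgn false := by
    refine hom_ext fun l => ?_
    rw [LinearMap.comp_apply, boundary_single, h true, LinearMap.comp_apply,
      ← listBoundary_insertionSort, evalAlternating_listBoundary]
    simp [fan, evalAlternating, sort]
  exact LinearMap.congr_fun this c

lemma alternating_map {f : α → α} {l : List α} (h : ∀ x ∈ l, sgn (f x) = !sgn x) (b : Bool) :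
    alternating sgn b (l.map f) = alternating sgn (!b) l := by
  induction l generalizing b with
  | nil => rfl
  | cons x l ih =>
    have := h x (by simp)
    cases b <;> cases hx : sgn x <;>
      simp [alternating, this, hx, ih fun y hy => h y (by simp [hy])]

lemma fan_map {f : α → α} {c : TupleChain α}
    (hc : c ∈ supported (ZMod 2) (ZMod 2) {l | ∀ x ∈ l, key (f x) = key x ∧ sgn (f x) = !sgn x}) :
    fan key sgn true (map f c) = fan key sgn false c := by
  have : fan key sgn true (map f c) = linearCombination (ZMod 2) (fun l =>
      alternating sgn true ((l.map f).insertionSort fun x y => key x ≤ key y)) c := by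
    have : fan key sgn true ∘ₗ map f = _ := hom_ext (g := linearCombination (ZMod 2) (fun l =>
      alternating sgn true ((l.map f).insertionSort fun x y => key x ≤ key y)))
        fun l => by simp [fan]
    exact LinearMap.congr_fun this c
  rw [this, fan, linearCombination_apply, linearCombination_apply]
  refine Finsupp.sum_congr fun l hl => ?_
  have hl := hc hl
  simp only [Set.mem_ofPred_eq] at hl
  rw [← List.map_insertionSort (r := fun x y => key x ≤ key y), alternating_map]
  · simp
  · intro x hx
    exact (hl x ((List.mem_insertionSort _).1 hx)).2
  · intro x hx y hy
    simp [(hl x hx).1, (hl y hy).1]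

end Fan
end TupleChain
end Chains

section Octahedron

open TupleChain

/-- The unit sphere of the `ℓ¹` norm. -/
def octahedron (N : ℕ) : Set (EuclideanSpace ℝ (Fin N)) := {x | ∑ i, |x i| = 1}

lemma neg_mem_octahedron {N : ℕ} {x : EuclideanSpace ℝ (Fin N)} (hx : x ∈ octahedron N) :
    -x ∈ octahedron N := by
  simpa [octahedron] using hx

lemma norm_le_one_of_mem_octahedron {N : ℕ} {x : EuclideanSpace ℝ (Fin N)}
    (hx : x ∈ octahedron N) : ‖x‖ ≤ 1 := by
  have hx : ∑ i, |x i| = 1 := hx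
  rw [EuclideanSpace.norm_eq, Real.sqrt_le_iff, one_pow, ← hx]
  refine ⟨Finset.sum_nonneg fun i _ => abs_nonneg _, ?_⟩
  refine Finset.sum_le_sum fun i _ => ?_
  have : |x i| ≤ 1 := hx ▸ Finset.single_le_sum (f := fun i => |x i|)
    (fun i _ => abs_nonneg _) (Finset.mem_univ i)
  rw [Real.norm_eq_abs]
  nlinarith [abs_nonneg (x i)]

lemma isCompact_octahedron (N : ℕ) : IsCompact (octahedron N) := by
  refine Metric.isCompact_of_isClosed_isBounded (isClosed_eq (by fun_prop) continuous_const) ?_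
  refine (Metric.isBounded_closedBall (x := 0) (r := 1)).subset fun x hx => ?_
  simpa using norm_le_one_of_mem_octahedron hx

lemma zero_notMem_octahedron (N : ℕ) : (0 : EuclideanSpace ℝ (Fin N)) ∉ octahedron N := by
  simp [octahedron]

/-- Tuples of `k + 1` points on the `k`-dimensional coordinate subsphere of the octahedron, at
pairwise distance at most `d`. -/
def smallTuples (N k : ℕ) (d : ℝ) : Set (List (EuclideanSpace ℝ (Fin N))) :=
  {l | l.length = k + 1 ∧ (∀ x ∈ l, x ∈ octahedron N ∧ ∀ i : Fin N, k < i → x i = 0) ∧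
    ∀ x ∈ l, ∀ y ∈ l, dist x y ≤ d}

/-- Coning from the `k`-th coordinate vertex raises the dimension of small tuples by one. -/
lemma prism_lineMap_mem {N k : ℕ} (hk : k + 1 < N) {d δ s t : ℝ} (hs : 0 ≤ s) (hst : s ≤ t)
    (ht : t ≤ 1) (hδ : 2 * (t - s) ≤ δ) {c : TupleChain (EuclideanSpace ℝ (Fin N))}
    (hc : c ∈ supported (ZMod 2) (ZMod 2) (smallTuples N k d)) :
    prism (fun x => AffineMap.lineMap x (EuclideanSpace.single ⟨k + 1, hk⟩ 1) s)
      (fun x => AffineMap.lineMap x (EuclideanSpace.single ⟨k + 1, hk⟩ 1) t) c ∈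
      supported (ZMod 2) (ZMod 2) (smallTuples N (k + 1) (d + δ)) := by
  refine linearCombination_mem (fun l hl => ?_) hc
  refine supported_mono ?_ (listPrism_mem _ _ l)
  rintro u ⟨hu, hul⟩
  obtain ⟨hl1, hl2, hl3⟩ := hl
  set e : EuclideanSpace ℝ (Fin N) := EuclideanSpace.single ⟨k + 1, hk⟩ 1 with he
  have hen : ‖e‖ = 1 := by simp [he]
  have hmem : ∀ x ∈ l, ∀ r : ℝ, 0 ≤ r → r ≤ 1 → AffineMap.lineMap x e r ∈ octahedron N ∧
      ∀ i : Fin N, k + 1 < i → (AffineMap.lineMap x e r : EuclideanSpace ℝ (Fin N)) i = 0 := by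
    intro x hx r hr hr1
    obtain ⟨hx1, hx2⟩ := hl2 x hx
    have hx1 : ∑ i, |x i| = 1 := hx1
    constructor
    · have : ∀ i : Fin N, |(AffineMap.lineMap x e r : EuclideanSpace ℝ (Fin N)) i| =
          (1 - r) * |x i| + if i = ⟨k + 1, hk⟩ then r else 0 := by
        intro i
        rw [AffineMap.lineMap_apply_module]
        by_cases hi : i = ⟨k + 1, hk⟩
        · have := hx2 i (by simp [hi])
          simp [this, he, hi]
          simp [← hi, this, abs_of_nonneg hr]
        · simp [he, hi, abs_mul, abs_of_nonneg (sub_nonneg.2 hr1)]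
      simp only [octahedron, Set.mem_ofPred_eq, this, Finset.sum_add_distrib, ← Finset.mul_sum, hx1]
      simp
    · intro i hi
      have hne : i ≠ ⟨k + 1, hk⟩ := fun h => by simp [h] at hi
      rw [AffineMap.lineMap_apply_module]
      simp [he, hne, hx2 i (by omega)]
  have hdist : ∀ x ∈ l, ∀ y ∈ l, ∀ r q : ℝ, 0 ≤ r → r ≤ 1 → 2 * |r - q| ≤ δ →
      dist (AffineMap.lineMap x e r : EuclideanSpace ℝ (Fin N)) (AffineMap.lineMap y e q) ≤
        d + δ := by
    intro x hx y hy r q hr hr1 hrq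
    have h1 : (AffineMap.lineMap x e r - AffineMap.lineMap y e q : EuclideanSpace ℝ (Fin N)) =
        (1 - r) • (x - y) + (r - q) • (e - y) := by
      rw [AffineMap.lineMap_apply_module, AffineMap.lineMap_apply_module]
      module
    have h2 : ‖e - y‖ ≤ 2 := by
      have := norm_sub_le e y
      have := norm_le_one_of_mem_octahedron (hl2 y hy).1
      linarith
    have h3 := hl3 x hx y hy
    rw [dist_eq_norm] at h3 ⊢
    rw [h1]
    refine (norm_add_le _ _).trans ?_
    rw [norm_smul, norm_smul, Real.norm_eq_abs, Real.norm_eq_abs,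
      abs_of_nonneg (sub_nonneg.2 hr1)]
    nlinarith [norm_nonneg (x - y), abs_nonneg (r - q)]
  have hts : |t - s| = t - s := abs_of_nonneg (sub_nonneg.2 hst)
  refine ⟨by rw [hu, hl1], fun y hy => ?_, fun y hy z hz => ?_⟩
  · obtain ⟨x, hx, rfl | rfl⟩ := hul y hy
    · simpa using hmem x hx s hs (by linarith)
    · simpa using hmem x hx t (by linarith) ht
  · obtain ⟨x, hx, hxy⟩ := hul y hy
    obtain ⟨w, hw, hwz⟩ := hul z hz
    rcases hxy with rfl | rfl <;> rcases hwz with rfl | rfl <;>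
      refine hdist x hx w hw _ _ ?_ ?_ ?_ <;>
      (try simp only [sub_self, abs_zero, hts, abs_sub_comm s t]) <;> linarith

lemma neg_mem_smallTuples {N k : ℕ} {d : ℝ} {l : List (EuclideanSpace ℝ (Fin N))}
    (hl : l ∈ smallTuples N k d) : l.map Neg.neg ∈ smallTuples N k d := by
  obtain ⟨h1, h2, h3⟩ := hl
  refine ⟨by simpa using h1, fun x hx => ?_, fun x hx y hy => ?_⟩
  · obtain ⟨x, hx', rfl⟩ := List.mem_map.1 hx
    exact ⟨neg_mem_octahedron (h2 x hx').1, fun i hi => by simp [(h2 x hx').2 i hi]⟩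
  · obtain ⟨x, hx', rfl⟩ := List.mem_map.1 hx
    obtain ⟨y, hy', rfl⟩ := List.mem_map.1 hy
    simpa using h3 x hx' y hy'

lemma sum_range_add_succ {M : Type*} [AddCommGroup M] [Module (ZMod 2) M] (u : ℕ → M) (n : ℕ) :
    ∑ s ∈ Finset.range n, (u s + u (s + 1)) = u 0 + u n := by
  induction n with
  | zero => simp [ZModModule.add_self]
  | succ n ih =>
    rw [Finset.sum_range_succ, ih]
    linear_combination (norm := abel) ZModModule.add_self (u n)

lemma map_eq_self {α : Type*} {f : α → α} (hf : ∀ x, f x = x) (c : TupleChain α) :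
    TupleChain.map f c = c := by
  have : TupleChain.map f = LinearMap.id := hom_ext fun l => by simp [funext hf]
  exact LinearMap.congr_fun this c

/-- The antipodal symmetrization of any chain dies under a constant map. -/
lemma map_const_symmetrization {α β : Type*} [Neg α] (y : β) (c : TupleChain α) :
    TupleChain.map (fun _ => y) (c + TupleChain.map Neg.neg c) = 0 := by
  rw [map_add, TupleChain.map_map]
  exact ZModModule.add_self _

/-- Arbitrarily fine symmetric mod-2 cycles with odd alternating count in each dimension. -/
lemma exists_small_cycle {N : ℕ} {key : EuclideanSpace ℝ (Fin N) → ℕ}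
    {sgn : EuclideanSpace ℝ (Fin N) → Bool}
    (hkey : ∀ x ∈ octahedron N, key (-x) = key x ∧ sgn (-x) = !sgn x)
    {δ : ℝ} (hδ : 0 < δ) {k : ℕ} (hk : k < N) :
    ∃ c ∈ supported (ZMod 2) (ZMod 2) (smallTuples N k (k * δ)),
      boundary (c + TupleChain.map Neg.neg c) = 0 ∧
      fan key sgn true (c + TupleChain.map Neg.neg c) = 1 := by
  have hfan : ∀ {k : ℕ} {d : ℝ}, ∀ c ∈ supported (ZMod 2) (ZMod 2) (smallTuples N k d),
      fan key sgn true (c + TupleChain.map Neg.neg c) = fan key sgn true (boundary c) := by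
    intro k d c hc
    rw [fan_boundary, map_add, fan_map]
    exact supported_mono (s := smallTuples N k d) (fun l hl x hx => hkey x (hl.2.1 x hx).1) hc
  induction k with
  | zero =>
    have hmem : single [EuclideanSpace.single ⟨0, hk⟩ 1] 1 ∈
        supported (ZMod 2) (ZMod 2) (smallTuples N 0 ((0 : ℕ) * δ)) := by
      refine single_mem_supported _ _ ⟨rfl, ?_, ?_⟩
      · simp only [List.mem_singleton, forall_eq]
        refine ⟨by simp [octahedron, apply_ite abs], fun i hi => ?_⟩
        have : i ≠ ⟨0, hk⟩ := fun h => by simp [h] at hi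
        simp [this]
      · simp
    refine ⟨_, hmem, ?_, ?_⟩
    · simp [boundary, listBoundary, ZModModule.add_self]
    · rw [hfan _ hmem]
      simp [boundary, listBoundary, fan, alternating]
  | succ k ih =>
    obtain ⟨c, hc, hbc, hfc⟩ := ih (by omega)
    set z := c + TupleChain.map Neg.neg c with hz
    have hzmem : z ∈ supported (ZMod 2) (ZMod 2) (smallTuples N k (k * δ)) :=
      Submodule.add_mem _ hc (map_mem (fun l hl => neg_mem_smallTuples hl) hc)
    obtain ⟨n, hn⟩ := exists_nat_gt (2 / δ)
    have hn0 : (0 : ℝ) < n := lt_trans (by positivity) hn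
    set h : ℕ → EuclideanSpace ℝ (Fin N) → EuclideanSpace ℝ (Fin N) := fun s x =>
      AffineMap.lineMap x (EuclideanSpace.single ⟨k + 1, hk⟩ 1) ((s : ℝ) / n) with hh
    set b := ∑ s ∈ Finset.range n, prism (h s) (h (s + 1)) z with hb
    have hbmem : b ∈ supported (ZMod 2) (ZMod 2) (smallTuples N (k + 1) ((k + 1 : ℕ) * δ)) := by
      refine Submodule.sum_mem _ fun s hs => ?_
      have hs : s + 1 ≤ n := Finset.mem_range.1 hs
      have hs' : (s : ℝ) + 1 ≤ n := by exact_mod_cast hs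
      have e : ((k + 1 : ℕ) : ℝ) * δ = k * δ + δ := by push_cast; ring
      rw [e]
      refine prism_lineMap_mem hk (by positivity) ?_ ?_ ?_ hzmem
      · gcongr; simp
      · rw [div_le_one hn0]; exact_mod_cast hs
      · rw [div_lt_iff₀ hδ] at hn
        rw [← sub_div, mul_div_assoc', div_le_iff₀ hn0]
        push_cast
        linarith
    have hbd : boundary b = z := by
      have : ∀ s ∈ Finset.range n, boundary (prism (h s) (h (s + 1)) z) =
          TupleChain.map (h s) z + TupleChain.map (h (s + 1)) z := fun s _ => by
        rw [← boundary_prism, hbc, map_zero, add_zero]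
      rw [hb, map_sum, Finset.sum_congr rfl this,
        sum_range_add_succ fun s => TupleChain.map (h s) z, map_eq_self (by simp [hh])]
      have : h n = fun _ => EuclideanSpace.single ⟨k + 1, hk⟩ 1 := by
        ext1 x; simp [hh, div_self hn0.ne']
      rw [this, hz, map_const_symmetrization, add_zero]
    refine ⟨b, hbmem, ?_, ?_⟩
    · rw [map_add, boundary_map, hbd, hz, map_add, TupleChain.map_map, map_eq_self (f := _ ∘ _)
        (by simp)]
      linear_combination (norm := abel) ZModModule.add_self c +
        ZModModule.add_self (TupleChain.map Neg.neg c)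
    · rw [hfan _ hbmem, hbd, hfc]

end Octahedron

section Alternating

open TupleChain

variable {α : Type*} {key : α → ℕ} {sgn : α → Bool}

/-- A sorted alternating tuple in which equal keys force equal signs has a set of distinct
positive keys containing half of its vertices. -/
lemma exists_positive_keys {b : Bool} {l : List α} (hsort : l.Pairwise fun x y => key x ≤ key y)
    (halt : alternating sgn b l ≠ 0) (hl : ∀ x ∈ l, ∀ y ∈ l, key x = key y → sgn x = sgn y) :
    ∃ F : Finset ℕ, F.card = (l.length + if b then 1 else 0) / 2 ∧
      ∀ i ∈ F, ∃ x ∈ l, sgn x = true ∧ key x = i := by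
  induction l generalizing b with
  | nil => exact ⟨∅, by cases b <;> simp, by simp⟩
  | cons x l ih =>
    rw [List.pairwise_cons] at hsort
    have hx : sgn x = b := by by_contra h; simp [alternating, h] at halt
    simp only [alternating, hx, if_true] at halt
    obtain ⟨F, hF, hFl⟩ := ih hsort.2 halt
      fun y hy z hz => hl y (by simp [hy]) z (by simp [hz])
    cases b with
    | false => exact ⟨F, by simpa using hF, fun i hi => by
        obtain ⟨y, hy, h⟩ := hFl i hi
        exact ⟨y, by simp [hy], h⟩⟩
    | true =>
      refine ⟨insert (key x) F, ?_, ?_⟩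
      · rw [Finset.card_insert_of_notMem, hF]
        · simp; omega
        · intro hi
          obtain ⟨y, hy, -, hyx⟩ := hFl _ hi
          cases l with
          | nil => simp at hy
          | cons z l =>
            have hz : sgn z = false := by by_contra h; simp [alternating, h] at halt
            have h1 := hsort.1 z (by simp)
            have h2 : key z ≤ key y := by
              rcases List.mem_cons.1 hy with rfl | hy
              · rfl
              · exact (List.pairwise_cons.1 hsort.2).1 y hy
            have := hl x (by simp) z (by simp) (by omega)
            simp [hx, hz] at this
      · simp only [Finset.mem_insert, forall_eq_or_imp]
        refine ⟨⟨x, by simp, hx, rfl⟩, fun i hi => ?_⟩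
        obtain ⟨y, hy, h⟩ := hFl i hi
        exact ⟨y, by simp [hy], h⟩

lemma exists_negative_max_key {b : Bool} {l : List α}
    (hsort : l.Pairwise fun x y => key x ≤ key y) (halt : alternating sgn b l ≠ 0)
    (hne : l ≠ []) (hlen : l.length % 2 = if b then 0 else 1) :
    ∃ y ∈ l, sgn y = false ∧ ∀ x ∈ l, key x ≤ key y := by
  induction l generalizing b with
  | nil => simp at hne
  | cons x l ih =>
    rw [List.pairwise_cons] at hsort
    have hx : sgn x = b := by by_contra h; simp [alternating, h] at halt
    simp only [alternating, hx, if_true] at halt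
    rcases eq_or_ne l [] with rfl | hl
    · cases b <;> simp at hlen
      exact ⟨x, by simp, hx, by simp⟩
    · obtain ⟨y, hy, hy1, hy2⟩ := ih hsort.2 halt hl (by
        cases b <;> simp at hlen ⊢ <;> omega)
      exact ⟨y, by simp [hy], hy1, by simpa using ⟨hsort.1 y hy, hy2⟩⟩

end Alternating

/-- Ky Fan's theorem for the octahedral sphere of odd dimension: an open cover by antipode-free
sets has multiplicity at least `m + 2` at some point. -/
theorem exists_mem_of_antipode_free {m : ℕ} {V : ℕ → Set (EuclideanSpace ℝ (Fin (2 * m + 2)))}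
    (hopen : ∀ i, IsOpen (V i)) (hcover : octahedron (2 * m + 2) ⊆ ⋃ i, V i)
    (hfree : ∀ i, ∀ x ∈ V i, -x ∉ V i) :
    ∃ x ∈ octahedron (2 * m + 2), ∃ F : Finset ℕ, F.card = m + 2 ∧ ∀ i ∈ F, x ∈ V i := by
  classical
  obtain ⟨ε, hε, hball⟩ :=
    lebesgue_number_lemma_of_metric (isCompact_octahedron _) hopen hcover
  set key : EuclideanSpace ℝ (Fin (2 * m + 2)) → ℕ := fun x =>
    sInf {i | Metric.ball x ε ⊆ V i ∨ Metric.ball (-x) ε ⊆ V i} with hkey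
  set sgn : EuclideanSpace ℝ (Fin (2 * m + 2)) → Bool := fun x =>
    decide (Metric.ball x ε ⊆ V (key x)) with hsgn
  have hor : ∀ x ∈ octahedron (2 * m + 2),
      Metric.ball x ε ⊆ V (key x) ∨ Metric.ball (-x) ε ⊆ V (key x) := fun x hx =>
    Nat.sInf_mem (s := {i | Metric.ball x ε ⊆ V i ∨ Metric.ball (-x) ε ⊆ V i})
      ((hball x hx).imp fun i hi => Or.inl hi)
  have hpos : ∀ x, sgn x = true → Metric.ball x ε ⊆ V (key x) := fun x h => by
    simpa [hsgn] using h
  have hneg : ∀ x ∈ octahedron (2 * m + 2), sgn x = false → Metric.ball (-x) ε ⊆ V (key x) :=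
    fun x hx h => (hor x hx).resolve_left (by simpa [hsgn] using h)
  have hkey_neg : ∀ x, key (-x) = key x := fun x => by simp [hkey, or_comm]
  have hodd : ∀ x ∈ octahedron (2 * m + 2), key (-x) = key x ∧ sgn (-x) = !sgn x := by
    refine fun x hx => ⟨hkey_neg x, ?_⟩
    cases h : sgn x
    · simpa [hsgn, hkey_neg] using hneg x hx h
    · have h1 := hpos x h (Metric.mem_ball_self hε)
      have h2 : ¬ Metric.ball (-x) ε ⊆ V (key x) := fun h2 =>
        hfree _ _ h1 (h2 (Metric.mem_ball_self hε))
      simpa [hsgn, hkey_neg] using h2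
  obtain ⟨c, hc, -, hfan⟩ := exists_small_cycle hodd (δ := ε / (2 * m + 2)) (by positivity)
    (k := 2 * m + 1) (by omega)
  have hzmem := Submodule.add_mem _ hc (TupleChain.map_mem (fun l hl => neg_mem_smallTuples hl) hc)
  obtain ⟨l, hl, hal⟩ : ∃ l ∈ smallTuples (2 * m + 2) (2 * m + 1)
      ((2 * m + 1 : ℕ) * (ε / (2 * m + 2))),
      TupleChain.alternating sgn true (l.insertionSort fun x y => key x ≤ key y) ≠ 0 := by
    by_contra! h
    have := TupleChain.linearCombination_mem (p := (⊥ : Submodule (ZMod 2) (ZMod 2)))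
      (fun l hl => (Submodule.mem_bot _).2 (h l hl)) hzmem
    rw [Submodule.mem_bot] at this
    exact one_ne_zero (hfan.symm.trans this)
  obtain ⟨hlen, hoct, hdist⟩ := hl
  have hdist : ∀ x ∈ l, ∀ y ∈ l, dist x y < ε := fun x hx y hy => by
    refine (hdist x hx y hy).trans_lt ?_
    rw [mul_div_assoc', div_lt_iff₀ (by positivity)]
    push_cast
    linarith
  set s := l.insertionSort fun x y => key x ≤ key y with hs
  have hmem : ∀ x, x ∈ s ↔ x ∈ l := fun x => List.mem_insertionSort _
  have hslen : s.length = 2 * m + 2 := by rw [hs, List.length_insertionSort, hlen]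
  have hsort : s.Pairwise fun x y => key x ≤ key y := by
    have : Std.Total fun x y => key x ≤ key y := ⟨fun x y => le_total _ _⟩
    have : IsTrans _ fun x y => key x ≤ key y := ⟨fun x y z => le_trans⟩
    exact List.pairwise_insertionSort _ l
  have hcompl : ∀ x ∈ l, ∀ y ∈ l, key x = key y → sgn x = true → sgn y ≠ false := by
    intro x hx y hy hxy h1 h2
    have h3 := hpos x h1 (Metric.mem_ball.2 (hdist y hy x hx))
    have h4 := hneg y (hoct y hy).1 h2 (Metric.mem_ball_self hε)
    exact hfree _ _ h3 (hxy ▸ h4)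
  obtain ⟨F, hF, hFs⟩ := exists_positive_keys hsort hal fun x hx y hy hxy => by
    have h1 := hcompl x ((hmem x).1 hx) y ((hmem y).1 hy) hxy
    have h2 := hcompl y ((hmem y).1 hy) x ((hmem x).1 hx) hxy.symm
    cases h : sgn x <;> cases h' : sgn y <;> simp_all
  obtain ⟨y, hy, hysgn, hymax⟩ := exists_negative_max_key hsort hal
    (by rw [← List.length_pos_iff, hslen]; omega) (by simp [hslen])
  have hyl := (hmem y).1 hy
  have hyoct := (hoct y hyl).1
  obtain ⟨j, hj⟩ := hball y hyoct
  have hjle : key y ≤ j := Nat.sInf_le (Or.inl hj)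
  have hjne : key y ≠ j := fun h => by
    simp [hsgn, h ▸ hj] at hysgn
  refine ⟨y, hyoct, insert j F, ?_, ?_⟩
  · rw [Finset.card_insert_of_notMem, hF, hslen]
    · simp; omega
    · intro hjF
      obtain ⟨x, hx, -, hxj⟩ := hFs j hjF
      have := hymax x hx
      omega
  · simp only [Finset.mem_insert, forall_eq_or_imp]
    refine ⟨hj (Metric.mem_ball_self hε), fun i hi => ?_⟩
    obtain ⟨x, hx, hxs, rfl⟩ := hFs i hi
    exact hpos x hxs (Metric.mem_ball.2 (hdist y hyl x ((hmem x).1 hx)))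

section Sectors

/-- Three disjoint open convex sectors of the plane. -/
def planeSector (j : Fin 3) : Set (ℝ × ℝ) :=
  ![{p | 0 < p.1 ∧ 0 < p.2}, {p | p.1 < 0 ∧ p.1 < p.2}, {p | p.2 < 0 ∧ p.2 < p.1}] j

lemma isOpen_planeSector (j : Fin 3) : IsOpen (planeSector j) := by
  fin_cases j
  · exact (isOpen_lt continuous_const continuous_fst).inter
      (isOpen_lt continuous_const continuous_snd)
  · exact (isOpen_lt continuous_fst continuous_const).inter
      (isOpen_lt continuous_fst continuous_snd)
  · exact (isOpen_lt continuous_snd continuous_const).inter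
      (isOpen_lt continuous_snd continuous_fst)

lemma neg_notMem_planeSector {j : Fin 3} {p : ℝ × ℝ} (hp : p ∈ planeSector j) :
    -p ∉ planeSector j := by
  fin_cases j <;> simp [planeSector] at hp ⊢ <;> intros <;> linarith

lemma planeSector_unique {i j : Fin 3} {p : ℝ × ℝ} (hi : p ∈ planeSector i)
    (hj : p ∈ planeSector j) : i = j := by
  fin_cases i <;> fin_cases j <;> simp [planeSector] at hi hj ⊢ <;> linarith

lemma eq_zero_of_notMem_planeSector {p : ℝ × ℝ} (hp : ∀ j, p ∉ planeSector j)
    (hp' : ∀ j, -p ∉ planeSector j) : p = 0 := by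
  have h0 := hp 0
  have h1 := hp 1
  have h2 := hp 2
  have h0' := hp' 0
  have h1' := hp' 1
  have h2' := hp' 2
  simp only [planeSector, Fin.isValue, Matrix.cons_val, Set.mem_ofPred_eq, Prod.fst_neg,
    Prod.snd_neg] at h0 h1 h2 h0' h1' h2'
  ext <;> simp <;> grind

variable {m : ℕ}

/-- The projection of `ℝ^(2m+2)` to its `k`-th coordinate plane. -/
def planeProj (k : Fin (m + 1)) (x : EuclideanSpace ℝ (Fin (2 * m + 2))) : ℝ × ℝ :=
  (x ⟨2 * k, by omega⟩, x ⟨2 * k + 1, by omega⟩)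

lemma continuous_planeProj (k : Fin (m + 1)) : Continuous (planeProj k) := by
  unfold planeProj
  fun_prop

lemma planeProj_neg (k : Fin (m + 1)) (x : EuclideanSpace ℝ (Fin (2 * m + 2))) :
    planeProj k (-x) = -planeProj k x := rfl

lemma eq_zero_of_planeProj {x : EuclideanSpace ℝ (Fin (2 * m + 2))}
    (h : ∀ k, planeProj k x = 0) : x = 0 := by
  ext i
  have hi := h ⟨i / 2, by omega⟩
  simp only [planeProj, Prod.mk_eq_zero] at hi
  rcases Nat.mod_two_eq_zero_or_one i with hp | hp
  · exact (congrArg x.ofLp (Fin.ext (by simp only; omega))).trans hi.1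
  · exact (congrArg x.ofLp (Fin.ext (by simp only; omega))).trans hi.2

variable (m) in
/-- The part of the sphere missed by all sectors of all coordinate planes. -/
def sectorGap : Set (EuclideanSpace ℝ (Fin (2 * m + 2))) :=
  Metric.sphere 0 1 ∩ ⋂ k : Fin (m + 1), ⋂ j, (planeProj k ⁻¹' planeSector j)ᶜ

lemma isClosed_sectorGap : IsClosed (sectorGap m) :=
  Metric.isClosed_sphere.inter <| isClosed_iInter fun k => isClosed_iInter fun j =>
    ((isOpen_planeSector j).preimage (continuous_planeProj k)).isClosed_compl

lemma neg_notMem_sectorGap {x : EuclideanSpace ℝ (Fin (2 * m + 2))} (hx : x ∈ sectorGap m) :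
    -x ∉ sectorGap m := by
  intro hx'
  simp only [sectorGap, Set.mem_inter_iff, Set.mem_iInter, Set.mem_compl_iff,
    Set.mem_preimage, planeProj_neg] at hx hx'
  have : x = 0 := eq_zero_of_planeProj fun k =>
    eq_zero_of_notMem_planeSector (hx.2 k) (hx'.2 k)
  simp [this] at hx

/-- Some open antipode-free set contains all of `sectorGap m`. -/
lemma exists_open_antipode_free_superset :
    ∃ B : Set (EuclideanSpace ℝ (Fin (2 * m + 2))), IsOpen B ∧ sectorGap m ⊆ B ∧
      ∀ x ∈ B, -x ∉ B := by
  refine ⟨{x | Metric.infDist x (sectorGap m) < Metric.infDist (-x) (sectorGap m)},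
    isOpen_lt (Metric.continuous_infDist_pt _)
      ((Metric.continuous_infDist_pt _).comp continuous_neg), fun x hx => ?_, fun x hx hx' => ?_⟩
  · have := (isClosed_sectorGap.notMem_iff_infDist_pos ⟨x, hx⟩).1 (neg_notMem_sectorGap hx)
    simpa [Metric.infDist_zero_of_mem hx] using this
  · simp only [Set.mem_ofPred_eq, neg_neg] at hx hx'
    exact hx.not_gt hx'

/-- The `2m+1`-sphere has a cover by antipode-free open sets of multiplicity `m + 2`. -/
lemma exists_antipode_free_cover (m : ℕ) :
    ∃ W : Option (Fin (m + 1) × Fin 3) → Set (EuclideanSpace ℝ (Fin (2 * m + 2))),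
      (∀ i, IsOpen (W i)) ∧ (Metric.sphere 0 1 ⊆ ⋃ i, W i) ∧ (∀ i, ∀ x ∈ W i, -x ∉ W i) ∧
      ∀ x, {i | x ∈ W i}.ncard ≤ m + 2 := by
  obtain ⟨B, hB, hgap, hfree⟩ := exists_open_antipode_free_superset (m := m)
  refine ⟨fun i => i.elim B fun p => planeProj p.1 ⁻¹' planeSector p.2, ?_, ?_, ?_, ?_⟩
  · rintro (_ | ⟨k, j⟩)
    · exact hB
    · exact (isOpen_planeSector j).preimage (continuous_planeProj k)
  · intro x hx
    by_cases h : ∃ p : Fin (m + 1) × Fin 3, planeProj p.1 x ∈ planeSector p.2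
    · obtain ⟨p, hp⟩ := h
      exact Set.mem_iUnion.2 ⟨some p, hp⟩
    · push Not at h
      refine Set.mem_iUnion.2 ⟨none, hgap ⟨hx, ?_⟩⟩
      simpa using fun k j => h (k, j)
  · rintro (_ | ⟨k, j⟩) x hx
    · exact hfree x hx
    · exact neg_notMem_planeSector hx
  · intro x
    calc _ ≤ (Set.univ : Set (Option (Fin (m + 1)))).ncard := by
          refine Set.ncard_le_ncard_of_injOn (Option.map Prod.fst) (fun _ _ => Set.mem_univ _) ?_
          rintro (_ | ⟨k, j⟩) hi (_ | ⟨k', j'⟩) hj hij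
          · rfl
          · simp at hij
          · simp at hij
          · obtain rfl : k = k' := by simpa using hij
            rw [planeSector_unique hi hj]
      _ = m + 2 := by simp [Set.ncard_univ]

end Sectors

/-- For odd `h = 2m + 1`, the minimal `l` such that the sphere `S^h` (unit sphere
in `ℝ^{h+1}`) can be covered by open sets, none containing a pair of antipodal
points, with every point contained in at most `l` of the sets, equals
`⌊h/2⌋ + 2 = m + 2 = (h+3)/2`. -/
theorem Q_odd (m : ℕ) :
    IsLeast {l : ℕ |
      ∃ (n : ℕ) (U : Fin n → Set (EuclideanSpace ℝ (Fin (2 * m + 2)))),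
        (∀ i, ∃ V, IsOpen V ∧ U i = V ∩ Metric.sphere 0 1) ∧
        (Metric.sphere (0 : EuclideanSpace ℝ (Fin (2 * m + 2))) 1 ⊆ ⋃ i, U i) ∧
        (∀ i, ∀ x, x ∈ U i → -x ∉ U i) ∧
        (∀ x ∈ Metric.sphere (0 : EuclideanSpace ℝ (Fin (2 * m + 2))) 1,
          {i : Fin n | x ∈ U i}.ncard ≤ l)} (m + 2) := by
  constructor
  · obtain ⟨W, hopen, hcover, hfree, hmult⟩ := exists_antipode_free_cover m
    let e := Fintype.equivFin (Option (Fin (m + 1) × Fin 3))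
    refine ⟨_, fun i => W (e.symm i) ∩ Metric.sphere 0 1, fun i => ⟨_, hopen _, rfl⟩,
      fun x hx => ?_, fun i x hx hx' => hfree _ x hx.1 hx'.1, fun x hx => ?_⟩
    · obtain ⟨i, hi⟩ := Set.mem_iUnion.1 (hcover hx)
      exact Set.mem_iUnion.2 ⟨e i, by simpa using hi, hx⟩
    · refine (Set.ncard_le_ncard_of_injOn e.symm (fun i hi => ?_) e.symm.injective.injOn).trans
        (hmult x)
      exact hi.1
  · rintro l ⟨n, U, hU, hcover, hfree, hmult⟩
    choose O hO hUO using hU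
    let V : ℕ → Set (EuclideanSpace ℝ (Fin (2 * m + 2))) := fun i =>
      ⋃ h : i < n, {x | x ≠ 0 ∧ ‖x‖⁻¹ • x ∈ O ⟨i, h⟩}
    have hsphere : ∀ x : EuclideanSpace ℝ (Fin (2 * m + 2)), x ≠ 0 →
        ‖x‖⁻¹ • x ∈ Metric.sphere (0 : EuclideanSpace ℝ (Fin (2 * m + 2))) 1 := fun x hx => by
      simp [norm_smul, hx]
    have hV : ∀ i x, x ∈ V i ↔ x ≠ 0 ∧ ∃ h : i < n, ‖x‖⁻¹ • x ∈ U ⟨i, h⟩ := by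
      intro i x
      simp only [V, Set.mem_iUnion, Set.mem_ofPred_eq, hUO]
      constructor
      · rintro ⟨h, hx, hxO⟩
        exact ⟨hx, h, hxO, hsphere x hx⟩
      · rintro ⟨hx, h, hxO⟩
        exact ⟨h, hx, hxO.1⟩
    obtain ⟨x, hx, F, hF, hFx⟩ := exists_mem_of_antipode_free (m := m) (V := V)
      (fun i => isOpen_iUnion fun h => by
        have : ContinuousOn (fun x : EuclideanSpace ℝ (Fin (2 * m + 2)) => ‖x‖⁻¹ • x) {0}ᶜ :=
          ContinuousOn.smul (continuousOn_id.norm.inv₀ fun x hx => by simpa using hx)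
            continuousOn_id
        exact this.isOpen_inter_preimage isOpen_compl_singleton (hO _))
      (fun x hx => by
        have hx0 : x ≠ 0 := fun h => zero_notMem_octahedron _ (h ▸ hx)
        obtain ⟨i, hi⟩ := Set.mem_iUnion.1 (hcover (hsphere x hx0))
        exact Set.mem_iUnion.2 ⟨i, (hV _ _).2 ⟨hx0, i.2, hi⟩⟩)
      (fun i x hx hx' => by
        obtain ⟨-, h, hx⟩ := (hV _ _).1 hx
        obtain ⟨-, _, hxn⟩ := (hV _ _).1 hx'
        exact hfree _ _ hx (by simpa using hxn))
    have hx0 : x ≠ 0 := fun h => zero_notMem_octahedron _ (h ▸ hx)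
    calc m + 2 = (F : Set ℕ).ncard := by rw [Set.ncard_coe_finset, hF]
      _ ≤ (Fin.val '' {i : Fin n | ‖x‖⁻¹ • x ∈ U i}).ncard := by
        refine Set.ncard_le_ncard (fun i hi => ?_) (Set.toFinite _)
        obtain ⟨-, h, hxU⟩ := (hV _ _).1 (hFx i hi)
        exact ⟨⟨i, h⟩, hxU, rfl⟩
      _ ≤ _ := Set.ncard_image_le (Set.toFinite _)
      _ ≤ l := hmult _ (hsphere x hx0)
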